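/- Let ν = Σ_{i=1}^N α_i δ_{A_i} be a laminate of finite order on ℝ^{2×2} with barycenter A = Σ_{i=1}^N α_i A_i (with Σ α_i = 1, α_i ≥ 0). Let Ω ⊂ ℝ² be a bounded open set, α ∈ (0,1), and 0 < δ < min_{i≠j} |A_i − A_j|/2. Then there exists a piecewise affine Lipschitz map f : closure(Ω) → ℝ² such that: (i) f(x) = Ax on ∂Ω; (ii) the C^α-Hölder norm of f − Ax on closure(Ω) is less than δ; (iii) |{x ∈ Ω : |∇f(x) − A_i| < δ}| = α_i·|Ω| for each i; (iv) dist(∇f(x), spt ν) < δ for a.e. x ∈ Ω. -/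

import Mathlib

noncomputable section
open MeasureTheory Complex Real

/-- Points of the plane. -/
abbrev Pt := Fin 2 → ℝ

/-- Euclidean norm on the plane. -/
def e2norm (v : Pt) : ℝ := Real.sqrt (v 0 ^ 2 + v 1 ^ 2)

/-- `u ∈ L¹(Ω)` has weak gradient `g ∈ L¹(Ω;ℝ²)`:
`∫ u ∂_iφ = −∫ g_i φ` for every test function `φ` supported in `Ω`. -/
def HasWeakGradientOn (u : Pt → ℝ) (g : Pt → Pt) (Ω : Set Pt) : Prop :=
  ∀ φ : Pt → ℝ, ContDiff ℝ (⊤ : ℕ∞) φ → HasCompactSupport φ → tsupport φ ⊆ Ω →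
    ∀ i : Fin 2,
      ∫ x in Ω, u x * fderiv ℝ φ x (Pi.single i 1) = -∫ x in Ω, g x i * φ x

/-- 2×2 real matrices. -/
abbrev Mat2 := Matrix (Fin 2) (Fin 2) ℝ

/-- Hilbert–Schmidt norm of a 2×2 matrix. -/
def hsNormM (A : Mat2) : ℝ :=
  Real.sqrt (A 0 0 ^ 2 + A 0 1 ^ 2 + A 1 0 ^ 2 + A 1 1 ^ 2)

/-- Distance of a matrix to a set of matrices in the Hilbert–Schmidt norm. -/
def setDistM (A : Mat2) (S : Set Mat2) : ℝ := sInf {r | ∃ Q ∈ S, r = hsNormM (A - Q)}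
/-- A finitely supported measure `Σ_i α_i δ_{A_i}` on `ℝ^{2×2}` is encoded as a
finitely supported weight function `ν : Mat2 →₀ ℝ`.  `IsLaminate ν` says that
`ν` is a laminate of finite order: it is obtained from a Dirac mass by finitely
many splittings of an atom `A = λB + (1−λ)C` along rank-one directions. -/
inductive IsLaminate : (Mat2 →₀ ℝ) → Prop
  | dirac (A : Mat2) : IsLaminate (Finsupp.single A 1)
  | split (ν : Mat2 →₀ ℝ) (A B C : Mat2) (lam : ℝ)
      (hlam : lam ∈ Set.Icc (0 : ℝ) 1) (hrank : (B - C).rank = 1)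
      (hA : A = lam • B + (1 - lam) • C) (hν : IsLaminate ν) :
      IsLaminate (Finsupp.erase A ν +
        ν A • (Finsupp.single B lam + Finsupp.single C (1 - lam)))

/-- `f` is piecewise affine on `Ω`, with (a.e.-defined) gradient `Df`. -/
def PiecewiseAffineOn (f : Pt → Pt) (Df : Pt → Mat2) (Ω : Set Pt) : Prop :=
  ∃ U : ℕ → Set Pt,
    (∀ i, IsOpen (U i)) ∧ (∀ i, U i ⊆ Ω) ∧
    (∀ i j, i ≠ j → Disjoint (U i) (U j)) ∧
    (∀ i, volume (frontier (U i)) = 0) ∧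
    volume (Ω \ ⋃ i, U i) = 0 ∧
    ∀ i, ∃ (M : Mat2) (b : Pt),
      (∀ x ∈ U i, f x = M.mulVec x + b) ∧ (∀ x ∈ U i, Df x = M)

/-- The copy `x + r P` of the set `P`. -/
def scaledCopy (P : Set Pt) (x : Pt) (r : ℝ) : Set Pt := {y | r⁻¹ • (y - x) ∈ P}

lemma volume_scaledCopy (P : Set Pt) (x : Pt) {r : ℝ} (hr : 0 < r) :
    volume (scaledCopy P x r) = ENNReal.ofReal (r ^ 2) * volume P := by
  have h1 : scaledCopy P x r = (fun y => y + -x) ⁻¹' ((fun y => r⁻¹ • y) ⁻¹' P) := by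
    ext y
    simp [scaledCopy, sub_eq_add_neg]
  rw [h1, measure_preimage_add_right, Measure.addHaar_preimage_smul _ (inv_ne_zero hr.ne')]
  simp

lemma isOpen_scaledCopy {P : Set Pt} (hP : IsOpen P) (x : Pt) (r : ℝ) :
    IsOpen (scaledCopy P x r) :=
  hP.preimage (f := fun y => r⁻¹ • (y - x)) (by fun_prop)

lemma isClosed_scaledCopy {P : Set Pt} (hP : IsClosed P) (x : Pt) (r : ℝ) :
    IsClosed (scaledCopy P x r) :=
  hP.preimage (f := fun y => r⁻¹ • (y - x)) (by fun_prop)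

lemma scaledCopy_mono {P Q : Set Pt} (h : P ⊆ Q) (x : Pt) (r : ℝ) :
    scaledCopy P x r ⊆ scaledCopy Q x r := fun _ hy => h hy

lemma scaledCopy_closedBall (x : Pt) {r : ℝ} (hr : 0 < r) (R : ℝ) :
    scaledCopy (Metric.closedBall 0 R) x r = Metric.closedBall x (R * r) := by
  ext y
  change r⁻¹ • (y - x) ∈ Metric.closedBall (0 : Pt) R ↔ _
  rw [mem_closedBall_zero_iff, Metric.mem_closedBall, dist_eq_norm, norm_smul, norm_inv,
    Real.norm_eq_abs, abs_of_pos hr, inv_mul_le_iff₀ hr, mul_comm]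

/-- Vitali covering of a set by small copies of a fixed convex-body-like set. -/
lemma exists_disjoint_scaledCopy {P : Set Pt} (hPc : IsClosed P) {R ρ : ℝ} (hρ : 0 < ρ)
    (hPR : P ⊆ Metric.closedBall 0 R) (hPρ : Metric.closedBall 0 ρ ⊆ P)
    (s : Set Pt) (good : Pt → ℝ → Prop)
    (hg : ∀ x ∈ s, ∃ ε > 0, ∀ r, 0 < r → r < ε → good x r) :
    ∃ u : Set (Pt × ℝ), u.Countable ∧ (∀ p ∈ u, 0 < p.2 ∧ good p.1 p.2) ∧
      u.PairwiseDisjoint (fun p => scaledCopy P p.1 p.2) ∧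
      volume (s \ ⋃ p ∈ u, scaledCopy P p.1 p.2) = 0 := by
  have hR : 0 < R := by
    have h1 : (fun _ => ρ : Pt) ∈ Metric.closedBall (0 : Pt) R := by
      apply hPR
      apply hPρ
      simp [abs_of_pos hρ]
    have : |ρ| ≤ R := by simpa using h1
    exact lt_of_lt_of_le hρ (le_trans (le_abs_self _) this)
  obtain ⟨u, hut, huc, hud, hu0⟩ := Vitali.exists_disjoint_covering_ae (volume : Measure Pt) s
    {p : Pt × ℝ | 0 < p.2 ∧ good p.1 p.2} (Real.toNNReal ((3 * R / ρ) ^ 2))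
    (fun p => R * p.2) Prod.fst (fun p => scaledCopy P p.1 p.2)
    (fun p hp => by
      rw [← scaledCopy_closedBall p.1 hp.1]
      exact scaledCopy_mono hPR _ _)
    (fun p hp => by
      have hp2 : 0 < p.2 := hp.1
      have h1 : volume (Metric.closedBall p.1 (ρ * p.2)) ≤ volume (scaledCopy P p.1 p.2) := by
        rw [← scaledCopy_closedBall p.1 hp.1]
        exact measure_mono (scaledCopy_mono hPρ _ _)
      refine le_trans ?_ (mul_le_mul' le_rfl h1)
      rw [Measure.addHaar_closedBall _ _ (by positivity),
        Measure.addHaar_closedBall _ _ (by positivity), ← mul_assoc (ENNReal.ofNNReal _)]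
      refine mul_le_mul' ?_ le_rfl
      change _ ≤ ENNReal.ofReal ((3 * R / ρ) ^ 2) * _
      rw [← ENNReal.ofReal_mul (by positivity)]
      apply ENNReal.ofReal_le_ofReal
      simp only [Module.finrank_fin_fun]
      apply le_of_eq
      field_simp)
    (fun p hp => by
      have hp2 : 0 < p.2 := hp.1
      refine ⟨p.1, ?_⟩
      rw [mem_interior_iff_mem_nhds]
      refine Filter.mem_of_superset (Metric.closedBall_mem_nhds p.1 (ε := ρ * p.2)
        (by positivity)) ?_
      rw [← scaledCopy_closedBall p.1 hp.1]
      exact scaledCopy_mono hPρ _ _)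
    (fun p _ => isClosed_scaledCopy hPc _ _)
    (fun x hx ε hε => by
      obtain ⟨ε', hε', h⟩ := hg x hx
      have hpos : 0 < min (ε / R) (ε' / 2) := by positivity
      refine ⟨(x, min (ε / R) (ε' / 2)), ⟨hpos, h _ hpos ?_⟩, ?_, rfl⟩
      · exact lt_of_le_of_lt (min_le_right _ _) (by linarith)
      · calc R * min (ε / R) (ε' / 2) ≤ R * (ε / R) := by gcongr; exact min_le_left _ _
          _ = ε := by field_simp)
  exact ⟨u, huc, fun p hp => hut hp, hud, hu0⟩

lemma volume_line (p c : ℝ) (q : ℝ) (h : 0 < p ^ 2 + q ^ 2) :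
    volume {x : Pt | p * x 0 + q * x 1 = c} = 0 := by
  let ℓ : Pt →ₗ[ℝ] ℝ := p • LinearMap.proj 0 + q • LinearMap.proj 1
  have hℓ : ∀ x, ℓ x = p * x 0 + q * x 1 := fun x => by simp [ℓ]
  have hne : LinearMap.ker ℓ ≠ ⊤ := by
    intro htop
    have h1 : (![p, q] : Pt) ∈ LinearMap.ker ℓ := htop ▸ Submodule.mem_top
    rw [LinearMap.mem_ker, hℓ] at h1
    simp at h1
    nlinarith
  have h0 := Measure.addHaar_submodule (volume : Measure Pt) _ hne
  rw [← measure_preimage_add_right volume (-(c / (p ^ 2 + q ^ 2)) • (![p, q] : Pt))] at h0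
  convert h0 using 2
  ext x
  simp only [Set.mem_ofPred_eq, Set.mem_preimage, SetLike.mem_coe, LinearMap.mem_ker, hℓ]
  simp only [Pi.add_apply, Pi.smul_apply, smul_eq_mul, Matrix.cons_val_zero, Matrix.cons_val_one]
  have : p * (x 0 + -(c / (p ^ 2 + q ^ 2)) * p) + q * (x 1 + -(c / (p ^ 2 + q ^ 2)) * q)
      = p * x 0 + q * x 1 - c := by
    field_simp
    ring
  rw [this, sub_eq_zero]

/-- A compactly supported pyramid whose gradient is close to `(1 - lam) n` and `-lam n`. -/
lemma exists_pyramid {lam : ℝ} (h0 : 0 < lam) (h1 : lam < 1) (n : Pt)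
    (hn : n 0 ^ 2 + n 1 ^ 2 = 1) {ε : ℝ} (hε : 0 < ε) (hε1 : ε ≤ 1) :
    ∃ (h : Pt → ℝ) (P L R : Set Pt) (r₁ r₂ : ℝ), IsClosed P ∧ 0 < r₁ ∧
      P ⊆ Metric.closedBall 0 r₂ ∧ Metric.closedBall 0 r₁ ⊆ P ∧
      LipschitzWith 4 h ∧ (∀ x, 0 ≤ h x) ∧ (∀ x, h x ≤ 1) ∧ (∀ x ∉ P, h x = 0) ∧
      IsOpen L ∧ IsOpen R ∧ L ⊆ P ∧ R ⊆ P ∧ Disjoint L R ∧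
      volume L = ENNReal.ofReal lam * volume P ∧
      volume R = ENNReal.ofReal (1 - lam) * volume P ∧
      (∀ x ∈ L, ∃ q : Pt, (∀ i, |q i - (1 - lam) * n i| ≤ ε) ∧
        ∀ᶠ y in nhds x, h y = h x + q ⬝ᵥ (y - x)) ∧
      (∀ x ∈ R, ∃ q : Pt, (∀ i, |q i - (-lam) * n i| ≤ ε) ∧
        ∀ᶠ y in nhds x, h y = h x + q ⬝ᵥ (y - x)) := by
  have hn0 : |n 0| ≤ 1 := abs_le_one_iff_mul_self_le_one.2 (by nlinarith [sq_nonneg (n 1)])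
  have hn1 : |n 1| ≤ 1 := abs_le_one_iff_mul_self_le_one.2 (by nlinarith [sq_nonneg (n 0)])
  have h1' : 0 < 1 - lam := by linarith
  let s : Pt → ℝ := fun x => n 0 * x 0 + n 1 * x 1
  let t : Pt → ℝ := fun x => -n 1 * x 0 + n 0 * x 1
  let G : Pt → ℝ := fun x => ε * |t x| + max (lam * s x) (-(1 - lam) * s x)
  have hsc : Continuous s := by fun_prop
  have htc : Continuous t := by fun_prop
  have hGc : Continuous G := by fun_prop
  have hcomb : ∀ a b : ℝ, |a| ≤ 1 → |b| ≤ 1 → ∀ x : Pt, |a * x 0 + b * x 1| ≤ 2 * ‖x‖ := by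
    intro a b ha hb x
    have hx0 : |x 0| ≤ ‖x‖ := norm_le_pi_norm x 0
    have hx1 : |x 1| ≤ ‖x‖ := norm_le_pi_norm x 1
    calc |a * x 0 + b * x 1| ≤ |a * x 0| + |b * x 1| := abs_add_le _ _
      _ = |a| * |x 0| + |b| * |x 1| := by rw [abs_mul, abs_mul]
      _ ≤ 1 * ‖x‖ + 1 * ‖x‖ := by gcongr
      _ = 2 * ‖x‖ := by ring
  have hsb : ∀ x y, |s x - s y| ≤ 2 * ‖x - y‖ := fun x y => by
    have := hcomb _ _ hn0 hn1 (x - y)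
    convert this using 2
    simp only [s, Pi.sub_apply]; ring
  have htb : ∀ x y, |t x - t y| ≤ 2 * ‖x - y‖ := fun x y => by
    have := hcomb (-n 1) _ (by rwa [abs_neg]) hn0 (x - y)
    convert this using 2
    simp only [t, Pi.sub_apply]; ring
  have hmaxb : ∀ a b : ℝ, max (lam * a) (-(1 - lam) * a) - max (lam * b) (-(1 - lam) * b)
      ≤ |a - b| := by
    intro a b
    have h2 := le_abs_self (a - b)
    have h3 := neg_abs_le (a - b)
    rw [sub_le_iff_le_add]
    apply max_le
    · have := le_max_left (lam * b) (-(1 - lam) * b)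
      nlinarith
    · have := le_max_right (lam * b) (-(1 - lam) * b)
      nlinarith
  have hGb : ∀ x y, G x - G y ≤ 4 * ‖x - y‖ := by
    intro x y
    have h2 := hmaxb (s x) (s y)
    have h3 := hsb x y
    have h4 := htb x y
    have h5 : |t x| - |t y| ≤ |t x - t y| := abs_sub_abs_le_abs_sub _ _
    have h6 : ε * (|t x| - |t y|) ≤ 2 * ‖x - y‖ := by
      calc ε * (|t x| - |t y|) ≤ ε * (2 * ‖x - y‖) := by gcongr; linarith
        _ ≤ 1 * (2 * ‖x - y‖) := by gcongr
        _ = _ := by ring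
    simp only [G]
    linarith
  have hG0 : ∀ x, 0 ≤ G x := by
    intro x
    have : 0 ≤ max (lam * s x) (-(1 - lam) * s x) := by
      rcases le_total 0 (s x) with h | h
      · exact le_max_of_le_left (by positivity)
      · exact le_max_of_le_right (by nlinarith)
    positivity
  have hGz : G 0 = 0 := by simp [G, s, t]
  let P : Set Pt := {x | G x ≤ 1}
  let L : Set Pt := {x | s x < 0 ∧ t x ≠ 0 ∧ G x < 1}
  let R : Set Pt := {x | 0 < s x ∧ t x ≠ 0 ∧ G x < 1}
  have hLo : IsOpen L := (isOpen_lt hsc continuous_const).inter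
    ((isOpen_ne_fun htc continuous_const).inter (isOpen_lt hGc continuous_const))
  have hRo : IsOpen R := (isOpen_lt continuous_const hsc).inter
    ((isOpen_ne_fun htc continuous_const).inter (isOpen_lt hGc continuous_const))
  have hLP : L ⊆ P := fun x hx => le_of_lt hx.2.2
  have hRP : R ⊆ P := fun x hx => le_of_lt hx.2.2
  have hLR : Disjoint L R := Set.disjoint_left.2 fun x hx hx' => lt_asymm hx.1 hx'.1
  have hnull : volume (P \ (L ∪ R)) = 0 := by
    have hline : ∀ a b c : ℝ, 0 < a ^ 2 + b ^ 2 → volume {x | a * s x + b * t x = c} = 0 := by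
      intro a b c hab
      rw [← volume_line (a * n 0 - b * n 1) c (a * n 1 + b * n 0)]
      · congr 1; ext x; simp only [s, t, Set.mem_ofPred_eq]; ring_nf
      · have : (a * n 0 - b * n 1) ^ 2 + (a * n 1 + b * n 0) ^ 2 = a ^ 2 + b ^ 2 := by
          linear_combination (a ^ 2 + b ^ 2) * hn
        rwa [this]
    have hsub : P \ (L ∪ R) ⊆ {x | 1 * s x + 0 * t x = 0} ∪ ({x | 0 * s x + 1 * t x = 0} ∪
        ({x | lam * s x + ε * t x = 1} ∪ ({x | lam * s x + (-ε) * t x = 1} ∪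
        ({x | -(1 - lam) * s x + ε * t x = 1} ∪ {x | -(1 - lam) * s x + (-ε) * t x = 1})))) := by
      rintro x ⟨hxP, hx⟩
      simp only [Set.mem_union, not_or] at hx
      simp only [Set.mem_union, Set.mem_ofPred_eq]
      by_contra! hcon
      obtain ⟨c1, c2, c3, c4, c5, c6⟩ := hcon
      have hG1 : G x ≠ 1 := by
        intro hG
        simp only [G] at hG
        rcases abs_cases (t x) with ⟨ha, _⟩ | ⟨ha, _⟩ <;>
        rcases max_choice (lam * s x) (-(1 - lam) * s x) with hb | hb <;>
        rw [ha, hb] at hG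
        · exact c3 (by linarith)
        · exact c5 (by linarith)
        · exact c4 (by linarith)
        · exact c6 (by linarith)
      have hGlt : G x < 1 := lt_of_le_of_ne hxP hG1
      have ht : t x ≠ 0 := fun h => c2 (by linarith)
      rcases lt_trichotomy (s x) 0 with h | h | h
      · exact hx.1 ⟨h, ht, hGlt⟩
      · exact c1 (by linarith)
      · exact hx.2 ⟨h, ht, hGlt⟩
    refine measure_mono_null hsub ?_
    simp only [measure_union_null_iff]
    refine ⟨?_, ?_, ?_, ?_, ?_, ?_⟩ <;> apply hline <;> nlinarith
  have hvol : volume L + volume R = volume P := by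
    rw [← measure_union hLR hRo.measurableSet]
    apply le_antisymm (measure_mono (Set.union_subset hLP hRP))
    rw [← Set.inter_union_sdiff P (L ∪ R)]
    refine (measure_union_le _ _).trans ?_
    rw [hnull, add_zero]
    exact measure_mono Set.inter_subset_right
  have hLvol : volume L = ENNReal.ofReal (lam / (1 - lam)) * volume R := by
    let T : Mat2 := !![1 - n 0 ^ 2 / lam, -(n 0 * n 1) / lam;
      -(n 0 * n 1) / lam, 1 - n 1 ^ 2 / lam]
    have hdet : LinearMap.det (Matrix.toLin' T) = -((1 - lam) / lam) := by
      rw [LinearMap.det_toLin', Matrix.det_fin_two_of]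
      field_simp
      linear_combination (-lam) * hn
    have hs : ∀ x, s (Matrix.toLin' T x) = -((1 - lam) / lam) * s x := by
      intro x
      simp only [s, T, Matrix.toLin'_apply, Matrix.mulVec, dotProduct, Fin.sum_univ_two]
      simp
      field_simp
      linear_combination (-(n 0 * x 0 + n 1 * x 1)) * hn
    have ht : ∀ x, t (Matrix.toLin' T x) = t x := by
      intro x
      simp only [t, T, Matrix.toLin'_apply, Matrix.mulVec, dotProduct, Fin.sum_univ_two]
      simp
      field_simp
      ring
    have hG : ∀ x, s x < 0 → G (Matrix.toLin' T x) = G x := by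
      intro x hx
      simp only [G, hs, ht]
      have e1 : lam * (-((1 - lam) / lam) * s x) = -(1 - lam) * s x := by field_simp
      have hpos : 0 < -((1 - lam) / lam) * s x := by
        have : 0 < (1 - lam) / lam := by positivity
        nlinarith
      have e2 : max (lam * (-((1 - lam) / lam) * s x))
          (-(1 - lam) * (-((1 - lam) / lam) * s x)) = -(1 - lam) * s x := by
        rw [max_eq_left (by nlinarith), e1]
      rw [e2, max_eq_right (by nlinarith)]
    have hpre : (Matrix.toLin' T) ⁻¹' R = L := by
      have hc : 0 < (1 - lam) / lam := by positivity
      have hiff : ∀ x, 0 < s (Matrix.toLin' T x) ↔ s x < 0 := by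
        intro x
        rw [hs]
        constructor <;> intro h <;> nlinarith
      ext x
      simp only [Set.mem_preimage, L, R, Set.mem_ofPred_eq, ht, hiff]
      constructor
      · rintro ⟨h2, h3, h4⟩
        exact ⟨h2, h3, hG x h2 ▸ h4⟩
      · rintro ⟨h2, h3, h4⟩
        exact ⟨h2, h3, (hG x h2).symm ▸ h4⟩
    have hd0 : LinearMap.det (Matrix.toLin' T) ≠ 0 := by
      rw [hdet]
      have : 0 < (1 - lam) / lam := by positivity
      linarith
    rw [← hpre, Measure.addHaar_preimage_linearMap _ hd0, hdet]
    congr 2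
    rw [inv_neg, abs_neg, inv_div, abs_of_pos (by positivity)]
  have hRvol : volume R = ENNReal.ofReal ((1 - lam) / lam) * volume L := by
    rw [hLvol, ← mul_assoc, ← ENNReal.ofReal_mul (by positivity)]
    have : (1 - lam) / lam * (lam / (1 - lam)) = 1 := by field_simp
    rw [this]; simp
  have hsplit : ENNReal.ofReal lam + ENNReal.ofReal (1 - lam) = 1 := by
    rw [← ENNReal.ofReal_add h0.le h1'.le]; simp
  have hgrad : ∀ x, G x < 1 → ∀ q : Pt, (∀ᶠ y in nhds x, 1 - G y = 1 - G x + q ⬝ᵥ (y - x)) →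
      ∀ᶠ y in nhds x, max (1 - G y) 0 = max (1 - G x) 0 + q ⬝ᵥ (y - x) := by
    intro x hx q hq
    filter_upwards [hq, (isOpen_lt hGc continuous_const).mem_nhds hx] with y hy hy1
    have hy1 : G y < 1 := hy1
    rw [max_eq_left (by linarith), max_eq_left (by linarith), hy]
  have hgrad2 : ∀ x, t x ≠ 0 → G x < 1 → ∀ c : ℝ,
      (∀ᶠ y in nhds x, max (lam * s y) (-(1 - lam) * s y) = -c * s y) →
      ∃ q : Pt, (∀ i, |q i - c * n i| ≤ ε) ∧
        ∀ᶠ y in nhds x, max (1 - G y) 0 = max (1 - G x) 0 + q ⬝ᵥ (y - x) := by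
    intro x htx hGx c hc
    have key : ∀ σ : ℝ, |σ| = 1 → (∀ᶠ y in nhds x, |t y| = σ * t y) →
        ∃ q : Pt, (∀ i, |q i - c * n i| ≤ ε) ∧
        ∀ᶠ y in nhds x, max (1 - G y) 0 = max (1 - G x) 0 + q ⬝ᵥ (y - x) := by
      intro σ hσ hts
      refine ⟨![c * n 0 + σ * ε * n 1, c * n 1 - σ * ε * n 0], ?_, hgrad x hGx _ ?_⟩
      · have hb : ∀ a : ℝ, |a| ≤ 1 → |σ * ε * a| ≤ ε := by
          intro a ha
          rw [abs_mul, abs_mul, hσ, abs_of_pos hε]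
          nlinarith
        intro i
        fin_cases i
        · simpa using hb _ hn1
        · simpa [abs_sub_comm] using hb _ hn0
      · have e1 := hts.self_of_nhds
        have e2 := hc.self_of_nhds
        filter_upwards [hts, hc] with y hy1 hy2
        simp only [G]
        rw [hy1, hy2, e1, e2]
        simp [s, t, dotProduct, Fin.sum_univ_two]
        ring
    rcases lt_or_gt_of_ne htx with h | h
    · refine key (-1) (by simp) ?_
      filter_upwards [(isOpen_lt htc continuous_const).mem_nhds h] with y hy
      rw [abs_of_neg hy]; ring
    · refine key 1 (by simp) ?_
      filter_upwards [(isOpen_lt continuous_const htc).mem_nhds h] with y hy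
      rw [abs_of_pos hy]; ring
  refine ⟨fun x => max (1 - G x) 0, P, L, R, 1 / 4, 1 / ε + 1 / lam + 1 / (1 - lam),
    isClosed_le hGc continuous_const, by norm_num, ?_, ?_, ?_, fun x => le_max_right _ _,
    fun x => max_le (by linarith [hG0 x]) zero_le_one, ?_, hLo, hRo, hLP, hRP, hLR, ?_, ?_, ?_, ?_⟩
  · intro x hx
    have hx : ε * |t x| + max (lam * s x) (-(1 - lam) * s x) ≤ 1 := hx
    have ha := le_max_left (lam * s x) (-(1 - lam) * s x)
    have hb := le_max_right (lam * s x) (-(1 - lam) * s x)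
    have hm : 0 ≤ max (lam * s x) (-(1 - lam) * s x) := by
      rcases le_total 0 (s x) with h | h
      · exact le_max_of_le_left (by positivity)
      · exact le_max_of_le_right (by nlinarith)
    have ht0 := abs_nonneg (t x)
    have ht : |t x| ≤ 1 / ε := by
      rw [le_div_iff₀ hε]; linarith
    have hs : |s x| ≤ 1 / lam + 1 / (1 - lam) := by
      have h2 : s x ≤ 1 / lam := by
        rw [le_div_iff₀ h0]; nlinarith
      have h3 : -s x ≤ 1 / (1 - lam) := by
        rw [le_div_iff₀ h1']; nlinarith
      have h4 : 0 < 1 / lam := by positivity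
      have h5 : 0 < 1 / (1 - lam) := by positivity
      rw [abs_le]; constructor <;> linarith
    have hbd : ∀ a b c d : ℝ, |a| ≤ 1 → |b| ≤ 1 → |a * c + b * d| ≤ |c| + |d| := by
      intro a b c d ha hb
      calc |a * c + b * d| ≤ |a * c| + |b * d| := abs_add_le _ _
        _ = |a| * |c| + |b| * |d| := by rw [abs_mul, abs_mul]
        _ ≤ 1 * |c| + 1 * |d| := by gcongr
        _ = _ := by ring
    rw [mem_closedBall_zero_iff, pi_norm_le_iff_of_nonneg (by positivity)]
    intro i
    rw [Real.norm_eq_abs]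
    fin_cases i
    · have e : x 0 = n 0 * s x + (-n 1) * t x := by
        simp only [s, t]; linear_combination (-(x 0)) * hn
      have := hbd _ _ (s x) (t x) hn0 (by rwa [abs_neg] : |-n 1| ≤ 1)
      simp only [Fin.zero_eta]
      rw [e]
      linarith
    · have e : x 1 = n 1 * s x + n 0 * t x := by
        simp only [s, t]; linear_combination (-(x 1)) * hn
      have := hbd _ _ (s x) (t x) hn1 hn0
      simp only [Fin.mk_one]
      rw [e]
      linarith
  · intro x hx
    rw [mem_closedBall_zero_iff] at hx
    have := hGb x 0
    rw [hGz, sub_zero, sub_zero] at this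
    exact this.trans (by linarith)
  · have : LipschitzWith 4 (fun x => 1 - G x) := by
      apply LipschitzWith.of_le_add_mul
      intro x y
      have := hGb y x
      rw [dist_eq_norm, norm_sub_rev]
      push_cast
      linarith
    exact this.max_const 0
  · intro x hx
    have hx : ¬ G x ≤ 1 := hx
    exact max_eq_right (by linarith)
  · rw [← hvol, mul_add]
    rw [hRvol]
    rw [← mul_assoc, ← ENNReal.ofReal_mul h0.le, mul_div_cancel₀ _ h0.ne', ← add_mul, hsplit,
      one_mul]
  · rw [← hvol, mul_add]
    rw [hLvol]
    rw [← mul_assoc, ← ENNReal.ofReal_mul h1'.le, mul_div_cancel₀ _ h1'.ne', ← add_mul, hsplit,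
      one_mul]
  · rintro x ⟨hs, ht, hG⟩
    refine hgrad2 x ht hG (1 - lam) ?_
    filter_upwards [(isOpen_lt hsc continuous_const).mem_nhds hs] with y hy
    have hy : s y < 0 := hy
    exact max_eq_right (by nlinarith)
  · rintro x ⟨hs, ht, hG⟩
    refine hgrad2 x ht hG (-lam) ?_
    filter_upwards [(isOpen_lt continuous_const hsc).mem_nhds hs] with y hy
    have hy : 0 < s y := hy
    rw [neg_neg]
    exact max_eq_left (by nlinarith)

/-- A small scalar perturbation supported in an open set, with gradient close to
`(1 - lam) n` and `-lam n` on proportions `lam` and `1 - lam` of the set. -/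
lemma exists_scalar_layer {lam : ℝ} (h0 : 0 < lam) (h1 : lam < 1) (n : Pt)
    (hn : n 0 ^ 2 + n 1 ^ 2 = 1) {ε : ℝ} (hε : 0 < ε) (hε1 : ε ≤ 1) {η : ℝ} (hη : 0 < η)
    {V : Set Pt} (hV : IsOpen V) :
    ∃ (φ : Pt → ℝ) (L R : Set Pt), LipschitzWith 4 φ ∧ (∀ x, |φ x| ≤ η) ∧
      (∀ x ∉ V, φ x = 0) ∧ IsOpen L ∧ IsOpen R ∧ L ⊆ V ∧ R ⊆ V ∧ Disjoint L R ∧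
      volume L = ENNReal.ofReal lam * volume V ∧
      volume R = ENNReal.ofReal (1 - lam) * volume V ∧
      (∀ x ∈ L, ∃ q : Pt, (∀ i, |q i - (1 - lam) * n i| ≤ ε) ∧
        ∀ᶠ y in nhds x, φ y = φ x + q ⬝ᵥ (y - x)) ∧
      (∀ x ∈ R, ∃ q : Pt, (∀ i, |q i - (-lam) * n i| ≤ ε) ∧
        ∀ᶠ y in nhds x, φ y = φ x + q ⬝ᵥ (y - x)) := by
  obtain ⟨h, P, L, R, r₁, r₂, hPc, hr₁, hPr₂, hPr₁, hlip, hnn, hle, hz, hLo, hRo, hLP, hRP,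
    hLR, hLv, hRv, hLg, hRg⟩ := exists_pyramid h0 h1 n hn hε hε1
  have hr₂ : 0 ≤ r₂ := by
    have : (0 : Pt) ∈ Metric.closedBall (0 : Pt) r₂ :=
      hPr₂ (hPr₁ (Metric.mem_closedBall_self hr₁.le))
    simpa using this
  obtain ⟨u, huc, hu, hud, hu0⟩ := exists_disjoint_scaledCopy hPc hr₁ hPr₂ hPr₁ V
    (fun x r => r ≤ η ∧ scaledCopy P x r ⊆ V) (fun x hx => by
      obtain ⟨ε', hε', hb⟩ := Metric.isOpen_iff.1 hV x hx
      have hr : 0 < r₂ + 1 := by linarith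
      refine ⟨min η (ε' / (r₂ + 1)), by positivity, fun r hr0 hr1 =>
        ⟨(hr1.trans_le (min_le_left _ _)).le, ?_⟩⟩
      have h2 := hr1.trans_le (min_le_right _ _)
      rw [lt_div_iff₀ hr] at h2
      refine (scaledCopy_mono hPr₂ x r).trans ?_
      rw [scaledCopy_closedBall x hr0]
      exact (Metric.closedBall_subset_ball (by nlinarith)).trans hb)
  have hsub : ∀ p ∈ u, scaledCopy P p.1 p.2 ⊆ V := fun p hp => (hu p hp).2.2
  have hpos : ∀ p ∈ u, 0 < p.2 := fun p hp => (hu p hp).1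
  let H : Pt × ℝ → Pt → ℝ := fun p y => p.2 * h (p.2⁻¹ • (y - p.1))
  have hHz : ∀ p y, y ∉ scaledCopy P p.1 p.2 → H p y = 0 := fun p y hy => by
    simp only [H]
    rw [hz _ hy, mul_zero]
  have hHnn : ∀ p ∈ u, ∀ y, 0 ≤ H p y := fun p hp y => mul_nonneg (hpos p hp).le (hnn _)
  have hHle : ∀ p ∈ u, ∀ y, H p y ≤ η := fun p hp y => by
    have := hle (p.2⁻¹ • (y - p.1))
    have h3 := (hu p hp).2.1
    have h4 := hpos p hp
    simp only [H]
    nlinarith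
  have hHlip : ∀ p ∈ u, ∀ y z, H p y ≤ H p z + 4 * dist y z := fun p hp y z => by
    have h3 := hpos p hp
    have h4 := hlip.le_add_mul (p.2⁻¹ • (y - p.1)) (p.2⁻¹ • (z - p.1))
    rw [dist_smul₀, dist_sub_right, norm_inv, Real.norm_eq_abs, abs_of_pos h3] at h4
    push_cast at h4
    simp only [H]
    calc p.2 * h (p.2⁻¹ • (y - p.1))
        ≤ p.2 * (h (p.2⁻¹ • (z - p.1)) + 4 * (p.2⁻¹ * dist y z)) := by gcongr
      _ = p.2 * h (p.2⁻¹ • (z - p.1)) + 4 * dist y z := by field_simp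
  classical
  let φ : Pt → ℝ := fun y =>
    if hy : ∃ p ∈ u, y ∈ scaledCopy P p.1 p.2 then H hy.choose y else 0
  have hφ : ∀ p ∈ u, ∀ y ∈ scaledCopy P p.1 p.2, φ y = H p y := by
    intro p hp y hy
    have hex : ∃ p ∈ u, y ∈ scaledCopy P p.1 p.2 := ⟨p, hp, hy⟩
    have heq : hex.choose = p := by
      by_contra hne
      exact Set.disjoint_left.1 (hud hex.choose_spec.1 hp hne) hex.choose_spec.2 hy
    simp only [φ, dif_pos hex, heq]
  have hφ0 : ∀ y, (∀ p ∈ u, y ∉ scaledCopy P p.1 p.2) → φ y = 0 := by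
    intro y hy
    refine dif_neg ?_
    push Not
    exact hy
  have hφnn : ∀ y, 0 ≤ φ y := by
    intro y
    by_cases hy : ∃ p ∈ u, y ∈ scaledCopy P p.1 p.2
    · obtain ⟨p, hp, hy⟩ := hy
      rw [hφ p hp y hy]
      exact hHnn p hp y
    · push Not at hy
      rw [hφ0 y hy]
  have hφle : ∀ y, φ y ≤ η := by
    intro y
    by_cases hy : ∃ p ∈ u, y ∈ scaledCopy P p.1 p.2
    · obtain ⟨p, hp, hy⟩ := hy
      rw [hφ p hp y hy]
      exact hHle p hp y
    · push Not at hy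
      rw [hφ0 y hy]
      exact hη.le
  have hφge : ∀ p ∈ u, ∀ y, H p y ≤ φ y := by
    intro p hp y
    by_cases hy : y ∈ scaledCopy P p.1 p.2
    · rw [hφ p hp y hy]
    · rw [hHz p y hy]
      exact hφnn y
  have hvol : ∀ (S : Set Pt) (c : ℝ), IsOpen S → S ⊆ P →
      volume S = ENNReal.ofReal c * volume P →
      volume (⋃ p ∈ u, scaledCopy S p.1 p.2) = ENNReal.ofReal c * volume V := by
    intro S c hS hSP hSv
    have hVeq : volume V = volume (⋃ p ∈ u, scaledCopy P p.1 p.2) := by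
      apply le_antisymm _ (measure_mono (Set.iUnion₂_subset hsub))
      rw [← Set.sdiff_union_of_subset (Set.iUnion₂_subset hsub)]
      refine (measure_union_le _ _).trans ?_
      rw [hu0, zero_add]
    rw [hVeq, measure_biUnion huc hud fun p _ => (isClosed_scaledCopy hPc _ _).measurableSet,
      measure_biUnion huc (hud.mono fun p => scaledCopy_mono hSP _ _)
        fun p _ => (isOpen_scaledCopy hS _ _).measurableSet, ← ENNReal.tsum_mul_left]
    congr 1
    ext p
    rw [volume_scaledCopy _ _ (hpos p p.2), volume_scaledCopy _ _ (hpos p p.2), hSv]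
    ring
  have hgrad : ∀ (S : Set Pt) (c : ℝ), IsOpen S → S ⊆ P →
      (∀ x ∈ S, ∃ q : Pt, (∀ i, |q i - c * n i| ≤ ε) ∧
        ∀ᶠ y in nhds x, h y = h x + q ⬝ᵥ (y - x)) →
      ∀ x ∈ ⋃ p ∈ u, scaledCopy S p.1 p.2, ∃ q : Pt, (∀ i, |q i - c * n i| ≤ ε) ∧
        ∀ᶠ y in nhds x, φ y = φ x + q ⬝ᵥ (y - x) := by
    intro S c hS hSP hg x hx
    simp only [Set.mem_iUnion] at hx
    obtain ⟨p, hp, hx⟩ := hx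
    obtain ⟨q, hq, hev⟩ := hg _ hx
    refine ⟨q, hq, ?_⟩
    have hcont : Filter.Tendsto (fun y : Pt => p.2⁻¹ • (y - p.1)) (nhds x)
        (nhds (p.2⁻¹ • (x - p.1))) :=
      Continuous.tendsto (f := fun y : Pt => p.2⁻¹ • (y - p.1)) (by fun_prop) x
    filter_upwards [hcont.eventually hev, (isOpen_scaledCopy hS p.1 p.2).mem_nhds hx]
      with y hy hyS
    rw [hφ p hp y (scaledCopy_mono hSP _ _ hyS), hφ p hp x (scaledCopy_mono hSP _ _ hx)]
    simp only [H]
    have hp2 := (hpos p hp).ne'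
    rw [hy, ← smul_sub, sub_sub_sub_cancel_right, dotProduct_smul, smul_eq_mul, mul_add,
      mul_inv_cancel_left₀ hp2]
  refine ⟨φ, ⋃ p ∈ u, scaledCopy L p.1 p.2, ⋃ p ∈ u, scaledCopy R p.1 p.2, ?_, ?_, ?_,
    isOpen_biUnion fun p _ => isOpen_scaledCopy hLo _ _,
    isOpen_biUnion fun p _ => isOpen_scaledCopy hRo _ _,
    Set.iUnion₂_subset fun p hp => (scaledCopy_mono hLP _ _).trans (hsub p hp),
    Set.iUnion₂_subset fun p hp => (scaledCopy_mono hRP _ _).trans (hsub p hp), ?_,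
    hvol L _ hLo hLP hLv, hvol R _ hRo hRP hRv, hgrad L _ hLo hLP hLg, hgrad R _ hRo hRP hRg⟩
  · apply LipschitzWith.of_le_add_mul
    intro y z
    push_cast
    by_cases hy : ∃ p ∈ u, y ∈ scaledCopy P p.1 p.2
    · obtain ⟨p, hp, hy⟩ := hy
      rw [hφ p hp y hy]
      have h2 := hHlip p hp y z
      have h3 := hφge p hp z
      linarith
    · push Not at hy
      rw [hφ0 y hy]
      have h2 := hφnn z
      positivity
  · intro x
    rw [abs_of_nonneg (hφnn x)]
    exact hφle x
  · intro x hx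
    exact hφ0 x fun p hp hxp => hx (hsub p hp hxp)
  · simp only [Set.disjoint_iUnion_left, Set.disjoint_iUnion_right]
    intro p hp p' hp'
    by_cases hpp : p = p'
    · subst hpp
      exact Set.disjoint_left.2 fun x hx hx' => Set.disjoint_left.1 hLR hx hx'
    · exact (hud hp' hp (Ne.symm hpp)).mono (scaledCopy_mono hLP _ _) (scaledCopy_mono hRP _ _)

lemma hsNormM_eq_norm (A : Mat2) :
    hsNormM A = ‖(!₂[A 0 0, A 0 1, A 1 0, A 1 1] : EuclideanSpace ℝ (Fin 4))‖ := by
  rw [EuclideanSpace.norm_eq, hsNormM]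
  simp [Fin.sum_univ_four]

lemma hsNormM_add_le (A B : Mat2) : hsNormM (A + B) ≤ hsNormM A + hsNormM B := by
  rw [hsNormM_eq_norm, hsNormM_eq_norm, hsNormM_eq_norm]
  refine le_trans (le_of_eq ?_) (norm_add_le _ _)
  congr 1
  ext i
  fin_cases i <;> simp

lemma hsNormM_neg (A : Mat2) : hsNormM (-A) = hsNormM A := by
  simp [hsNormM]

lemma hsNormM_le_of_entry_le {A : Mat2} {c : ℝ} (hc : 0 ≤ c) (h : ∀ i j, |A i j| ≤ c) :
    hsNormM A ≤ 2 * c := by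
  have hs : ∀ i j, A i j ^ 2 ≤ c ^ 2 := fun i j =>
    sq_le_sq.2 (by rw [abs_of_nonneg hc]; exact h i j)
  refine Real.sqrt_le_iff.2 ⟨by positivity, ?_⟩
  linarith [hs 0 0, hs 0 1, hs 1 0, hs 1 1]

lemma e2norm_le_norm (v : Pt) : e2norm v ≤ 2 * ‖v‖ := by
  have h : ∀ i, v i ^ 2 ≤ ‖v‖ ^ 2 := fun i =>
    sq_le_sq.2 (by rw [abs_norm]; exact norm_le_pi_norm v i)
  refine Real.sqrt_le_iff.2 ⟨by positivity, ?_⟩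
  nlinarith [h 0, h 1]

lemma norm_le_e2norm (v : Pt) : ‖v‖ ≤ e2norm v := by
  refine (pi_norm_le_iff_of_nonneg (Real.sqrt_nonneg _)).2 fun i => ?_
  rw [Real.norm_eq_abs]
  apply Real.abs_le_sqrt
  fin_cases i
  · simpa using sq_nonneg (v 1)
  · simpa using sq_nonneg (v 0)

lemma exists_vecMulVec_of_rank_eq_one {D : Mat2} (hD : D.rank = 1) :
    ∃ a n : Pt, n 0 ^ 2 + n 1 ^ 2 = 1 ∧ D = Matrix.vecMulVec a n := by
  have hdet : D 0 0 * D 1 1 - D 0 1 * D 1 0 = 0 := by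
    rw [← Matrix.det_fin_two]
    by_contra h
    have := Matrix.rank_of_det_ne_zero h
    simp [hD] at this
  have key : ∀ p q c d : ℝ, p ^ 2 + q ^ 2 ≠ 0 → c * q = d * p → ∃ n : Pt,
      n 0 ^ 2 + n 1 ^ 2 = 1 ∧ (∃ b, p = b * n 0 ∧ q = b * n 1) ∧
        ∃ b, c = b * n 0 ∧ d = b * n 1 := by
    intro p q c d hpq hcd
    have hpos : 0 < p ^ 2 + q ^ 2 := lt_of_le_of_ne (by positivity) (Ne.symm hpq)
    have hr : 0 < Real.sqrt (p ^ 2 + q ^ 2) := Real.sqrt_pos.2 hpos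
    have hr2 := Real.sq_sqrt hpos.le
    set r := Real.sqrt (p ^ 2 + q ^ 2)
    refine ⟨![p / r, q / r], ?_, ⟨r, ?_, ?_⟩, ⟨(c * p + d * q) / r, ?_, ?_⟩⟩ <;>
      simp only [Matrix.cons_val_zero, Matrix.cons_val_one] <;> field_simp
    · exact hr2.symm
    · rw [hr2]; linear_combination q * hcd
    · rw [hr2]; linear_combination (-p) * hcd
  have hrow : ∃ n : Pt, n 0 ^ 2 + n 1 ^ 2 = 1 ∧ (∃ b, D 0 0 = b * n 0 ∧ D 0 1 = b * n 1) ∧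
      ∃ b, D 1 0 = b * n 0 ∧ D 1 1 = b * n 1 := by
    by_cases h0 : D 0 0 ^ 2 + D 0 1 ^ 2 = 0
    · by_cases h1 : D 1 0 ^ 2 + D 1 1 ^ 2 = 0
      · exfalso
        have e1 : D 0 0 = 0 := by nlinarith [sq_nonneg (D 0 0), sq_nonneg (D 0 1)]
        have e2 : D 0 1 = 0 := by nlinarith [sq_nonneg (D 0 0), sq_nonneg (D 0 1)]
        have e3 : D 1 0 = 0 := by nlinarith [sq_nonneg (D 1 0), sq_nonneg (D 1 1)]
        have e4 : D 1 1 = 0 := by nlinarith [sq_nonneg (D 1 0), sq_nonneg (D 1 1)]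
        have : D = 0 := by
          ext i j
          fin_cases i <;> fin_cases j <;> simpa
        rw [this, Matrix.rank_zero] at hD
        exact zero_ne_one hD
      · obtain ⟨n, hn, hb, hc⟩ := key _ _ (D 0 0) (D 0 1) h1 (by linarith)
        exact ⟨n, hn, hc, hb⟩
    · exact key _ _ (D 1 0) (D 1 1) h0 (by linarith)
  obtain ⟨n, hn, ⟨b, hb0, hb1⟩, ⟨c, hc0, hc1⟩⟩ := hrow
  refine ⟨![b, c], n, hn, ?_⟩
  ext i j
  fin_cases i <;> fin_cases j <;> simpa [Matrix.vecMulVec_apply]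

/-- The barycenter of a finitely supported weight. -/
abbrev barycenter (ν : Mat2 →₀ ℝ) : Mat2 := ν.sum fun B w => w • B

lemma barycenter_add (μ ν : Mat2 →₀ ℝ) : barycenter (μ + ν) = barycenter μ + barycenter ν :=
  Finsupp.sum_add_index' (fun _ => zero_smul _ _) fun _ _ _ => add_smul _ _ _

lemma barycenter_single (A : Mat2) (w : ℝ) : barycenter (Finsupp.single A w) = w • A :=
  Finsupp.sum_single_index (zero_smul _ _)

lemma barycenter_split (ν : Mat2 →₀ ℝ) {A B C : Mat2} {lam : ℝ}
    (hA : A = lam • B + (1 - lam) • C) :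
    barycenter (Finsupp.erase A ν +
      ν A • (Finsupp.single B lam + Finsupp.single C (1 - lam))) = barycenter ν := by
  have hc : ∀ c : ℝ, c • A = (c * lam) • B + (c * (1 - lam)) • C := fun c => by
    rw [hA, smul_add, smul_smul, smul_smul]
  conv_rhs => rw [← Finsupp.erase_add_single A ν]
  rw [barycenter_add, barycenter_add, smul_add, Finsupp.smul_single, Finsupp.smul_single,
    barycenter_add, barycenter_single, barycenter_single, barycenter_single,
    smul_eq_mul, smul_eq_mul, hc]

lemma IsLaminate.sum_eq_one {ν : Mat2 →₀ ℝ} (h : IsLaminate ν) : (ν.sum fun _ w => w) = 1 := by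
  have hadd : ∀ μ ν : Mat2 →₀ ℝ, ((μ + ν).sum fun _ w => w) =
      (μ.sum fun _ w => w) + ν.sum fun _ w => w := fun μ ν =>
    Finsupp.sum_add_index' (fun _ => rfl) fun _ _ _ => rfl
  have hsing : ∀ (A : Mat2) (w : ℝ), ((Finsupp.single A w).sum fun _ w => w) = w := fun A w =>
    Finsupp.sum_single_index rfl
  induction h with
  | dirac A => exact hsing A 1
  | split ν A B C lam hlam hrank hA hν ih =>
    rw [← Finsupp.erase_add_single A ν, hadd, hsing] at ih
    rw [hadd, smul_add, Finsupp.smul_single, Finsupp.smul_single, hadd, hsing, hsing,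
      smul_eq_mul, smul_eq_mul]
    linear_combination ih

/-- `u` is a perturbation of the affine map given by `A`, supported in `Ω`, bounded by `δ`, such
that on the open set `V B` the perturbed map is locally affine with gradient `δ`-close to `B`,
and `V B` has relative volume `ν B`. -/
structure IsRealization (ν : Mat2 →₀ ℝ) (A : Mat2) (Ω : Set Pt) (δ : ℝ) (u : Pt → Pt)
    (V : Mat2 → Set Pt) : Prop where
  eq_zero : ∀ x ∉ Ω, u x = 0
  norm_le : ∀ x, ‖u x‖ ≤ δ
  isOpen : ∀ B, IsOpen (V B)
  subset : ∀ B, V B ⊆ Ω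
  eq_of_mem : ∀ x B C, x ∈ V B → x ∈ V C → B = C
  volume_eq : ∀ B, volume.real (V B) = ν B * volume.real Ω
  affine : ∀ B, ∀ x ∈ V B, ∃ M : Mat2, hsNormM (M - B) < δ ∧
    ∀ᶠ y in nhds x, u y = u x + (M - A).mulVec (y - x)

lemma isRealization_dirac (A : Mat2) {Ω : Set Pt} (hΩ : IsOpen Ω) {δ : ℝ} (hδ : 0 < δ) :
    IsRealization (Finsupp.single A 1) A Ω δ 0 (fun B => {x | x ∈ Ω ∧ B = A}) where
  eq_zero := fun _ _ => rfl
  norm_le := fun x => by simpa using hδ.le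
  isOpen := fun B => hΩ.and isOpen_const
  subset := fun B x hx => hx.1
  eq_of_mem := fun x B C hB hC => hB.2.trans hC.2.symm
  volume_eq := fun B => by
    classical
    by_cases h : B = A <;> simp [h]
  affine := fun B x hx => ⟨A, by rw [hx.2, sub_self]; simpa [hsNormM] using hδ, by simp⟩

lemma IsRealization.exists_split {ν : Mat2 →₀ ℝ} {A₀ : Mat2} {Ω : Set Pt}
    (hΩ : Bornology.IsBounded Ω) {δ : ℝ} (hδ : 0 < δ) {u : Pt → Pt} {V : Mat2 → Set Pt}
    (hu : IsRealization ν A₀ Ω (δ / 2) u V) {K : NNReal} (hK : LipschitzWith K u)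
    {A B C : Mat2} {lam : ℝ} (h0 : 0 < lam) (h1 : lam < 1) (hA : A = lam • B + (1 - lam) • C)
    {a n : Pt} (hn : n 0 ^ 2 + n 1 ^ 2 = 1) (han : B - C = Matrix.vecMulVec a n) :
    ∃ u' V', IsRealization (Finsupp.erase A ν +
      ν A • (Finsupp.single B lam + Finsupp.single C (1 - lam))) A₀ Ω δ u' V' ∧
      LipschitzWith (K + ‖a‖₊ * 4) u' := by
  classical
  have hε : 0 < min 1 (δ / (8 * (‖a‖ + 1))) := by positivity
  obtain ⟨φ, L, R, hφl, hφb, hφ0, hLo, hRo, hLV, hRV, hLR, hLv, hRv, hLg, hRg⟩ :=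
    exists_scalar_layer h0 h1 n hn hε (min_le_left _ _)
      (η := δ / (2 * (‖a‖ + 1))) (by positivity) (hu.isOpen A)
  have hεa : 2 * (‖a‖ * min 1 (δ / (8 * (‖a‖ + 1)))) < δ / 2 := by
    calc 2 * (‖a‖ * min 1 (δ / (8 * (‖a‖ + 1))))
        ≤ 2 * ((‖a‖ + 1) * (δ / (8 * (‖a‖ + 1)))) := by
          gcongr
          · linarith
          · exact min_le_right _ _
      _ = δ / 4 := by field_simp; ring
      _ < δ / 2 := by linarith
  set ε := min 1 (δ / (8 * (‖a‖ + 1)))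
  have haff : ∀ (S : Set Pt) (c : ℝ) (D : Mat2), S ⊆ V A →
      D - A = c • Matrix.vecMulVec a n →
      (∀ x ∈ S, ∃ q : Pt, (∀ i, |q i - c * n i| ≤ ε) ∧
        ∀ᶠ y in nhds x, φ y = φ x + q ⬝ᵥ (y - x)) →
      ∀ x ∈ S, ∃ M : Mat2, hsNormM (M - D) < δ ∧
        ∀ᶠ y in nhds x, u y + φ y • a = u x + φ x • a + (M - A₀).mulVec (y - x) := by
    intro S c D hS hD hg x hx
    obtain ⟨q, hq, hqe⟩ := hg x hx
    obtain ⟨M, hM, hMe⟩ := hu.affine A x (hS hx)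
    refine ⟨M + Matrix.vecMulVec a q, ?_, ?_⟩
    · have e : M + Matrix.vecMulVec a q - D =
          (M - A) + (Matrix.vecMulVec a q - c • Matrix.vecMulVec a n) := by
        rw [← hD]; abel
      have hb : hsNormM (Matrix.vecMulVec a q - c • Matrix.vecMulVec a n) ≤ 2 * (‖a‖ * ε) := by
        refine hsNormM_le_of_entry_le (by positivity) fun i j => ?_
        have e2 : (Matrix.vecMulVec a q - c • Matrix.vecMulVec a n) i j =
            a i * (q j - c * n j) := by
          simp [Matrix.vecMulVec_apply]; ring
        rw [e2, abs_mul]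
        exact mul_le_mul (norm_le_pi_norm a i) (hq j) (abs_nonneg _) (norm_nonneg _)
      rw [e]
      have := hsNormM_add_le (M - A) (Matrix.vecMulVec a q - c • Matrix.vecMulVec a n)
      linarith
    · filter_upwards [hqe, hMe] with y hy1 hy2
      rw [hy1, hy2, add_sub_right_comm, Matrix.add_mulVec, Matrix.vecMulVec_mulVec,
        op_smul_eq_smul]
      module
  let V' : Mat2 → Set Pt := fun D =>
    ({x | D ≠ A ∧ x ∈ V D} ∪ {x | D = B ∧ x ∈ L}) ∪ {x | D = C ∧ x ∈ R}
  have hmem : ∀ D x, x ∈ V' D ↔ (D ≠ A ∧ x ∈ V D) ∨ (D = B ∧ x ∈ L) ∨ (D = C ∧ x ∈ R) :=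
    fun D x => or_assoc
  refine ⟨fun x => u x + φ x • a, V', ?_, ?_⟩
  · constructor
    · intro x hx
      rw [hu.eq_zero x hx, hφ0 x fun h => hx (hu.subset A h), zero_smul, add_zero]
    · intro x
      refine (norm_add_le _ _).trans ?_
      rw [norm_smul, Real.norm_eq_abs]
      have h2 : |φ x| * ‖a‖ ≤ δ / (2 * (‖a‖ + 1)) * (‖a‖ + 1) := by
        gcongr
        · exact hφb x
        · linarith
      have h3 : δ / (2 * (‖a‖ + 1)) * (‖a‖ + 1) = δ / 2 := by field_simp
      linarith [hu.norm_le x]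
    · intro D
      exact ((isOpen_const.and (hu.isOpen D)).union (isOpen_const.and hLo)).union
        (isOpen_const.and hRo)
    · intro D x hx
      rcases (hmem D x).1 hx with h | h | h
      · exact hu.subset D h.2
      · exact hu.subset A (hLV h.2)
      · exact hu.subset A (hRV h.2)
    · intro x D E hD hE
      have hLR' : x ∈ L → x ∉ R := fun h => Set.disjoint_left.1 hLR h
      have hL' : x ∈ L → x ∈ V A := fun h => hLV h
      have hR' : x ∈ R → x ∈ V A := fun h => hRV h
      rcases (hmem D x).1 hD with h | h | h <;> rcases (hmem E x).1 hE with h' | h' | h'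
      · exact hu.eq_of_mem x D E h.2 h'.2
      · exact absurd (hu.eq_of_mem x D A h.2 (hL' h'.2)) h.1
      · exact absurd (hu.eq_of_mem x D A h.2 (hR' h'.2)) h.1
      · exact absurd (hu.eq_of_mem x E A h'.2 (hL' h.2)) h'.1
      · exact h.1.trans h'.1.symm
      · exact absurd h'.2 (hLR' h.2)
      · exact absurd (hu.eq_of_mem x E A h'.2 (hR' h.2)) h'.1
      · exact absurd h.2 (hLR' h'.2)
      · exact h.1.trans h'.1.symm
    · intro D
      have hfin : ∀ S, S ⊆ Ω → volume S ≠ ⊤ := fun S hS =>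
        ((measure_mono hS).trans_lt hΩ.measure_lt_top).ne
      have hLΩ : L ⊆ Ω := hLV.trans (hu.subset A)
      have hRΩ : R ⊆ Ω := hRV.trans (hu.subset A)
      have hLr : volume.real L = lam * (ν A * volume.real Ω) := by
        rw [← hu.volume_eq A, Measure.real, hLv, ENNReal.toReal_mul, ENNReal.toReal_ofReal h0.le]
        rfl
      have hRr : volume.real R = (1 - lam) * (ν A * volume.real Ω) := by
        rw [← hu.volume_eq A, Measure.real, hRv, ENNReal.toReal_mul,
          ENNReal.toReal_ofReal (by linarith)]
        rfl
      have hs1 : {x | D ≠ A ∧ x ∈ V D} ⊆ Ω := fun x hx => hu.subset D hx.2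
      have hs2 : {x | D = B ∧ x ∈ L} ⊆ Ω := fun x hx => hLΩ hx.2
      have hs3 : {x | D = C ∧ x ∈ R} ⊆ Ω := fun x hx => hRΩ hx.2
      have hd1 : Disjoint {x | D ≠ A ∧ x ∈ V D} {x | D = B ∧ x ∈ L} :=
        Set.disjoint_left.2 fun x hx hx' => hx.1 (hu.eq_of_mem x D A hx.2 (hLV hx'.2))
      have hd2 : Disjoint ({x | D ≠ A ∧ x ∈ V D} ∪ {x | D = B ∧ x ∈ L})
          {x | D = C ∧ x ∈ R} := by
        refine Set.disjoint_left.2 fun x hx hx' => ?_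
        rcases hx with hx | hx
        · exact hx.1 (hu.eq_of_mem x D A hx.2 (hRV hx'.2))
        · exact Set.disjoint_left.1 hLR hx.2 hx'.2
      rw [measureReal_union hd2 (isOpen_const.and hRo).measurableSet
          (hfin _ (Set.union_subset hs1 hs2)) (hfin _ hs3),
        measureReal_union hd1 (isOpen_const.and hLo).measurableSet (hfin _ hs1) (hfin _ hs2)]
      have hif : ∀ (p : Prop) [Decidable p] (S : Set Pt),
          volume.real {x | p ∧ x ∈ S} = if p then volume.real S else 0 := by
        intro p _ S
        split_ifs with hp <;> simp [hp]
      rw [hif, hif, hif, hLr, hRr, hu.volume_eq D]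
      simp only [Finsupp.add_apply, Finsupp.smul_apply, Finsupp.single_apply, Finsupp.erase_apply,
        smul_eq_mul, eq_comm (a := B), eq_comm (a := C), ne_eq, ite_not]
      split_ifs <;> ring
    · intro D x hx
      rcases (hmem D x).1 hx with h | h | h
      · obtain ⟨M, hM, hMe⟩ := hu.affine D x h.2
        refine ⟨M, by linarith, ?_⟩
        have hzero : ∀ y ∈ V D, φ y = 0 := fun y hy =>
          hφ0 y fun hyA => h.1 (hu.eq_of_mem y D A hy hyA)
        filter_upwards [hMe, (hu.isOpen D).mem_nhds h.2] with y hy hyD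
        rw [hzero y hyD, hzero x h.2, hy, zero_smul, add_zero, add_zero]
      · obtain ⟨rfl, hxL⟩ := h
        refine haff L (1 - lam) D hLV ?_ hLg x hxL
        rw [← han, hA]
        module
      · obtain ⟨rfl, hxR⟩ := h
        refine haff R (-lam) D hRV ?_ hRg x hxR
        rw [← han, hA]
        module
  · refine hK.add (LipschitzWith.of_dist_le_mul fun x y => ?_)
    have := hφl.dist_le_mul x y
    rw [dist_eq_norm, ← sub_smul, norm_smul, ← dist_eq_norm]
    push_cast at this ⊢
    calc dist (φ x) (φ y) * ‖a‖ ≤ 4 * dist x y * ‖a‖ := by gcongr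
      _ = ‖a‖ * 4 * dist x y := by ring

lemma IsLaminate.exists_realization {ν : Mat2 →₀ ℝ} (h : IsLaminate ν) :
    ∃ K : NNReal, ∀ Ω : Set Pt, IsOpen Ω → Bornology.IsBounded Ω → ∀ δ : ℝ, 0 < δ →
      ∃ u V, IsRealization ν (barycenter ν) Ω δ u V ∧ LipschitzWith K u := by
  induction h with
  | dirac A =>
    refine ⟨0, fun Ω hΩ _ δ hδ => ⟨0, fun B => {x | x ∈ Ω ∧ B = A}, ?_, LipschitzWith.const 0⟩⟩
    rw [barycenter_single, one_smul]
    exact isRealization_dirac A hΩ hδ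
  | split ν A B C lam hlam hrank hA hν ih =>
    rw [barycenter_split ν hA]
    obtain ⟨K, hK⟩ := ih
    rcases hlam.1.eq_or_lt with h0 | h0
    · refine ⟨K, ?_⟩
      have : A = C := by rw [hA, ← h0]; simp
      simpa [← h0, ← this, Finsupp.erase_add_single] using hK
    rcases hlam.2.eq_or_lt with h1 | h1
    · refine ⟨K, ?_⟩
      have : A = B := by rw [hA, h1]; simp
      simpa [h1, ← this, Finsupp.erase_add_single] using hK
    obtain ⟨a, n, hn, han⟩ := exists_vecMulVec_of_rank_eq_one hrank
    refine ⟨K + ‖a‖₊ * 4, fun Ω hΩ hΩb δ hδ => ?_⟩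
    obtain ⟨u, V, hu, huK⟩ := hK Ω hΩ hΩb (δ / 2) (by positivity)
    exact hu.exists_split hΩb hδ huK h0 h1 hA hn han

lemma toMatrix'_fderiv_of_eventually_affine {f : Pt → Pt} {M : Mat2} {b x : Pt}
    (h : ∀ᶠ y in nhds x, f y = M.mulVec y + b) :
    LinearMap.toMatrix' (fderiv ℝ f x : Pt →ₗ[ℝ] Pt) = M := by
  have h1 : HasFDerivAt (fun y => M.mulVecLin.toContinuousLinearMap y + b)
      M.mulVecLin.toContinuousLinearMap x :=
    (ContinuousLinearMap.hasFDerivAt _).add_const b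
  have h2 : HasFDerivAt f M.mulVecLin.toContinuousLinearMap x := h1.congr_of_eventuallyEq h
  rw [h2.fderiv, LinearMap.coe_toContinuousLinearMap, ← Matrix.toLin'_apply',
    LinearMap.toMatrix'_toLin']

/-- A map which is locally affine on a set of full measure is piecewise affine. -/
lemma piecewiseAffineOn_of_locally_affine {f : Pt → Pt} {Ω G : Set Pt} (hΩ : IsOpen Ω)
    (hGΩ : G ⊆ Ω) (hG0 : volume (Ω \ G) = 0)
    (hG : ∀ x ∈ G, ∃ (M : Mat2) (b : Pt), ∀ᶠ y in nhds x, f y = M.mulVec y + b) :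
    PiecewiseAffineOn f (fun x => LinearMap.toMatrix' (fderiv ℝ f x : Pt →ₗ[ℝ] Pt)) Ω := by
  obtain ⟨u, huc, hu, hud, hu0⟩ := exists_disjoint_scaledCopy
    (P := Metric.closedBall 0 1) Metric.isClosed_closedBall one_pos le_rfl le_rfl G
    (fun x r => Metric.ball x r ⊆ Ω ∧
      ∃ (M : Mat2) (b : Pt), ∀ y ∈ Metric.ball x r, f y = M.mulVec y + b)
    (fun x hx => by
      obtain ⟨M, b, hMb⟩ := hG x hx
      obtain ⟨ε, hε, h⟩ := Metric.eventually_nhds_iff_ball.1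
        (hMb.and (hΩ.mem_nhds (hGΩ hx)))
      exact ⟨ε, hε, fun r _ hr => ⟨fun y hy => (h y (Metric.ball_subset_ball hr.le hy)).2,
        M, b, fun y hy => (h y (Metric.ball_subset_ball hr.le hy)).1⟩⟩)
  have hball : ∀ p ∈ u, scaledCopy (Metric.closedBall 0 1) p.1 p.2 =
      Metric.closedBall p.1 p.2 := fun p hp => by
    rw [scaledCopy_closedBall _ (hu p hp).1, one_mul]
  obtain ⟨g, hg⟩ := Set.countable_iff_exists_injOn.1 huc
  let U : ℕ → Set Pt := fun i => {y | ∃ p ∈ u, g p = i ∧ y ∈ Metric.ball p.1 p.2}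
  have hU : ∀ i, U i = ∅ ∨ ∃ p ∈ u, U i = Metric.ball p.1 p.2 := by
    intro i
    by_cases h : ∃ p ∈ u, g p = i
    · obtain ⟨p, hp, rfl⟩ := h
      refine Or.inr ⟨p, hp, Set.ext fun y => ⟨?_, fun hy => ⟨p, hp, rfl, hy⟩⟩⟩
      rintro ⟨p', hp', hpp, hy⟩
      rwa [← hg hp' hp hpp]
    · refine Or.inl (Set.eq_empty_of_forall_notMem ?_)
      rintro y ⟨p, hp, hpi, -⟩
      exact h ⟨p, hp, hpi⟩
  have hUo : ∀ i, IsOpen (U i) := fun i => by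
    rcases hU i with h | ⟨p, -, h⟩ <;> rw [h]
    · exact isOpen_empty
    · exact Metric.isOpen_ball
  refine ⟨U, hUo, ?_, ?_, ?_, ?_, ?_⟩
  · rintro i y ⟨p, hp, -, hy⟩
    exact (hu p hp).2.1 hy
  · intro i j hij
    refine Set.disjoint_left.2 ?_
    rintro y ⟨p, hp, rfl, hy⟩ ⟨p', hp', rfl, hy'⟩
    have hne : p ≠ p' := fun h => hij (by rw [h])
    have hd : Disjoint (scaledCopy (Metric.closedBall 0 1) p.1 p.2)
      (scaledCopy (Metric.closedBall 0 1) p'.1 p'.2) := hud hp hp' hne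
    rw [hball p hp, hball p' hp'] at hd
    exact Set.disjoint_left.1 hd (Metric.ball_subset_closedBall hy)
      (Metric.ball_subset_closedBall hy')
  · intro i
    rcases hU i with h | ⟨p, -, h⟩ <;> rw [h]
    · simp
    · exact (convex_ball _ _).addHaar_frontier volume
  · have hsub : Ω \ ⋃ i, U i ⊆ (Ω \ G) ∪
        ((G \ ⋃ p ∈ u, scaledCopy (Metric.closedBall 0 1) p.1 p.2) ∪
          ⋃ p ∈ u, Metric.sphere p.1 p.2) := by
      rintro y ⟨hyΩ, hyU⟩
      by_cases hyG : y ∈ G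
      · right
        by_cases hyu : y ∈ ⋃ p ∈ u, scaledCopy (Metric.closedBall 0 1) p.1 p.2
        · right
          simp only [Set.mem_iUnion] at hyu ⊢
          obtain ⟨p, hp, hy⟩ := hyu
          rw [hball p hp] at hy
          refine ⟨p, hp, ?_⟩
          by_contra hs
          refine hyU (Set.mem_iUnion.2 ⟨g p, p, hp, rfl, ?_⟩)
          exact lt_of_le_of_ne hy hs
        · exact Or.inl ⟨hyG, hyu⟩
      · exact Or.inl ⟨hyΩ, hyG⟩
    refine measure_mono_null hsub (measure_union_null hG0 (measure_union_null hu0 ?_))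
    exact (measure_biUnion_null_iff huc).2 fun p _ => Measure.addHaar_sphere _ _ _
  · intro i
    rcases hU i with h | ⟨p, hp, h⟩
    · rw [h]
      exact ⟨0, 0, by simp, by simp⟩
    · obtain ⟨M, b, hMb⟩ := (hu p hp).2.2
      rw [h]
      refine ⟨M, b, hMb, fun x hx => toMatrix'_fderiv_of_eventually_affine (b := b) ?_⟩
      filter_upwards [Metric.isOpen_ball.mem_nhds hx] with y hy
      exact hMb y hy

lemma exists_small_holder {K α δ : ℝ} (hα : α < 1) (hδ : 0 < δ) :
    ∃ η, 0 < η ∧ η ≤ δ ∧ 2 * η + 2 * (K ^ α * (2 * η) ^ (1 - α)) < δ := by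
  have hc : Continuous fun η : ℝ => 2 * η + 2 * (K ^ α * (2 * η) ^ (1 - α)) := by
    have : Continuous fun η : ℝ => (2 * η) ^ (1 - α) :=
      (continuous_const.mul continuous_id).rpow_const fun _ => Or.inr (by linarith)
    fun_prop
  have h0 : 2 * (0 : ℝ) + 2 * (K ^ α * (2 * 0) ^ (1 - α)) < δ := by
    rw [mul_zero, Real.zero_rpow (by linarith)]
    simpa using hδ
  have h1 := (hc.tendsto 0).eventually (gt_mem_nhds h0)
  obtain ⟨η, hη, hη1, hη2⟩ := ((h1.filter_mono nhdsWithin_le_nhds).and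
    (Ioc_mem_nhdsGT hδ)).exists
  exact ⟨η, hη1, hη2, hη⟩

lemma le_rpow_interpolation {a p q α : ℝ} (ha : 0 ≤ a) (hp : a ≤ p) (hq : a ≤ q) (hα0 : 0 ≤ α)
    (hα1 : α ≤ 1) : a ≤ p ^ α * q ^ (1 - α) := by
  have h1 : 0 ≤ 1 - α := by linarith
  have h2 : 0 ≤ p ^ α := Real.rpow_nonneg (ha.trans hp) α
  calc a = a ^ α * a ^ (1 - α) := by
        rw [← Real.rpow_add_of_nonneg ha hα0 h1, add_sub_cancel, Real.rpow_one]
    _ ≤ p ^ α * q ^ (1 - α) := by gcongr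

/-- Proposition 2.3 of the paper: convex integration of a
laminate of finite order.  The barycenter of `ν` is `Σ_B ν(B) • B`. -/
theorem statement17 (ν : Mat2 →₀ ℝ) (hν : IsLaminate ν)
    (Ω : Set Pt) (hΩo : IsOpen Ω) (hΩb : Bornology.IsBounded Ω)
    (α : ℝ) (hα : α ∈ Set.Ioo (0 : ℝ) 1)
    (δ : ℝ) (hδ : 0 < δ)
    (hδ' : ∀ B ∈ ν.support, ∀ C ∈ ν.support, B ≠ C → δ < hsNormM (B - C) / 2) :
    ∃ (f : Pt → Pt) (Df : Pt → Mat2) (L : ℝ),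
      -- `f` is a piecewise affine Lipschitz map on the closure of `Ω`
      ContinuousOn f (closure Ω) ∧
      (∀ x ∈ closure Ω, ∀ y ∈ closure Ω, e2norm (f x - f y) ≤ L * e2norm (x - y)) ∧
      PiecewiseAffineOn f Df Ω ∧
      -- (i) boundary condition `f(x) = Ax` on `∂Ω`
      (∀ x ∈ frontier Ω, f x = (ν.sum fun B w => w • B).mulVec x) ∧
      -- (ii) `C^α` Hölder norm of `f − Ax` smaller than `δ`
      (∃ C₁ C₂ : ℝ, 0 ≤ C₁ ∧ 0 ≤ C₂ ∧ C₁ + C₂ < δ ∧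
        (∀ x ∈ closure Ω,
          e2norm (f x - (ν.sum fun B w => w • B).mulVec x) ≤ C₁) ∧
        (∀ x ∈ closure Ω, ∀ y ∈ closure Ω,
          e2norm ((f x - (ν.sum fun B w => w • B).mulVec x) -
              (f y - (ν.sum fun B w => w • B).mulVec y)) ≤
            C₂ * e2norm (x - y) ^ α)) ∧
      -- (iii) volume fractions
      (∀ B ∈ ν.support,
        (volume {x | x ∈ Ω ∧ hsNormM (Df x - B) < δ}).toReal =
          ν B * (volume Ω).toReal) ∧
      -- (iv) `dist(∇f, spt ν) < δ` a.e. in `Ω`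
      (∀ᵐ x ∂volume, x ∈ Ω → setDistM (Df x) (↑ν.support) < δ) := by
  obtain ⟨K, hK⟩ := hν.exists_realization
  obtain ⟨η, hη0, hηδ, hη⟩ := exists_small_holder (K := K) hα.2 hδ
  obtain ⟨u, V, hu, huK⟩ := hK Ω hΩo hΩb η hη0
  change IsRealization ν (ν.sum fun B w => w • B) Ω η u V at hu
  set A : Mat2 := ν.sum fun B w => w • B
  let f : Pt → Pt := fun x => A.mulVec x + u x
  have hfsub : ∀ x, f x - A.mulVec x = u x := fun x => add_sub_cancel_left _ _
  have hloc : ∀ B, ∀ x ∈ V B, ∃ (M : Mat2) (b : Pt), hsNormM (M - B) < δ ∧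
      ∀ᶠ y in nhds x, f y = M.mulVec y + b := by
    intro B x hx
    obtain ⟨M, hM, hMe⟩ := hu.affine B x hx
    refine ⟨M, u x - (M - A).mulVec x, hM.trans_le hηδ, ?_⟩
    filter_upwards [hMe] with y hy
    simp only [f, hy, Matrix.mulVec_sub, Matrix.sub_mulVec]
    abel
  have hDf : ∀ B, ∀ x ∈ V B,
      hsNormM (LinearMap.toMatrix' (fderiv ℝ f x : Pt →ₗ[ℝ] Pt) - B) < δ := by
    intro B x hx
    obtain ⟨M, b, hM, hMe⟩ := hloc B x hx
    rwa [toMatrix'_fderiv_of_eventually_affine hMe]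
  have hG0 : volume (Ω \ ⋃ B ∈ ν.support, V B) = 0 := by
    have hfin : volume Ω ≠ ⊤ := hΩb.measure_lt_top.ne
    have hsub : (⋃ B ∈ ν.support, V B) ⊆ Ω := Set.iUnion₂_subset fun B _ => hu.subset B
    have hmeas : MeasurableSet (⋃ B ∈ ν.support, V B) :=
      (isOpen_biUnion fun B _ => hu.isOpen B).measurableSet
    have hsum : volume.real (⋃ B ∈ ν.support, V B) = volume.real Ω := by
      rw [measureReal_biUnion_finset
        (fun B _ C _ hBC => Set.disjoint_left.2 fun x hB hC => hBC (hu.eq_of_mem x B C hB hC))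
        (fun B _ => (hu.isOpen B).measurableSet)
        (fun B _ => ((measure_mono (hu.subset B)).trans_lt hΩb.measure_lt_top).ne)]
      simp only [hu.volume_eq]
      rw [← Finset.sum_mul]
      have := hν.sum_eq_one
      rw [Finsupp.sum] at this
      rw [this, one_mul]
    rw [← measureReal_eq_zero_iff (measure_ne_top_of_subset Set.sdiff_subset hfin),
      measureReal_sdiff hsub hmeas hfin, hsum, sub_self]
  have hlip : ∀ x y, ‖f x - f y‖ ≤ (‖A.mulVecLin.toContinuousLinearMap‖ + K) * ‖x - y‖ := by
    intro x y
    have h1 : f x - f y = A.mulVecLin.toContinuousLinearMap (x - y) + (u x - u y) := by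
      simp only [f, LinearMap.coe_toContinuousLinearMap', Matrix.mulVecLin_apply,
        Matrix.mulVec_sub]
      abel
    rw [h1, add_mul]
    refine (norm_add_le _ _).trans (add_le_add (ContinuousLinearMap.le_opNorm _ _) ?_)
    rw [← dist_eq_norm, ← dist_eq_norm]
    exact huK.dist_le_mul x y
  have hfc : Continuous f := by
    have : Continuous fun x : Pt => A.mulVec x := Continuous.matrix_mulVec continuous_const
      continuous_id
    exact this.add huK.continuous
  refine ⟨f, fun x => LinearMap.toMatrix' (fderiv ℝ f x : Pt →ₗ[ℝ] Pt),
    2 * (‖A.mulVecLin.toContinuousLinearMap‖ + K), hfc.continuousOn, ?_, ?_, ?_,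
    ⟨2 * η, 2 * (K ^ α * (2 * η) ^ (1 - α)), by positivity, by positivity, hη, ?_, ?_⟩, ?_, ?_⟩
  · intro x _ y _
    calc e2norm (f x - f y) ≤ 2 * ‖f x - f y‖ := e2norm_le_norm _
      _ ≤ 2 * ((‖A.mulVecLin.toContinuousLinearMap‖ + K) * ‖x - y‖) := by gcongr; exact hlip x y
      _ ≤ 2 * ((‖A.mulVecLin.toContinuousLinearMap‖ + K) * e2norm (x - y)) := by
        gcongr; exact norm_le_e2norm _
      _ = _ := by ring
  · refine piecewiseAffineOn_of_locally_affine hΩo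
      (Set.iUnion₂_subset fun B _ => hu.subset B) hG0 fun x hx => ?_
    simp only [Set.mem_iUnion] at hx
    obtain ⟨B, -, hx⟩ := hx
    obtain ⟨M, b, -, h⟩ := hloc B x hx
    exact ⟨M, b, h⟩
  · intro x hx
    rw [hΩo.frontier_eq] at hx
    simp only [f, hu.eq_zero x hx.2, add_zero]
  · intro x _
    rw [hfsub]
    exact (e2norm_le_norm _).trans (by linarith [hu.norm_le x])
  · intro x _ y _
    rw [hfsub, hfsub]
    have h1 : ‖u x - u y‖ ≤ K * ‖x - y‖ := by
      rw [← dist_eq_norm, ← dist_eq_norm]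
      exact huK.dist_le_mul x y
    have h2 : ‖u x - u y‖ ≤ 2 * η :=
      (norm_sub_le _ _).trans (by linarith [hu.norm_le x, hu.norm_le y])
    have h3 := le_rpow_interpolation (norm_nonneg _) h1 h2 hα.1.le hα.2.le
    rw [Real.mul_rpow (NNReal.coe_nonneg K) (norm_nonneg _)] at h3
    have h4 : ‖x - y‖ ^ α ≤ e2norm (x - y) ^ α :=
      Real.rpow_le_rpow (norm_nonneg _) (norm_le_e2norm _) hα.1.le
    calc e2norm (u x - u y) ≤ 2 * ‖u x - u y‖ := e2norm_le_norm _
      _ ≤ 2 * (K ^ α * ‖x - y‖ ^ α * (2 * η) ^ (1 - α)) := by gcongr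
      _ ≤ 2 * (K ^ α * e2norm (x - y) ^ α * (2 * η) ^ (1 - α)) := by gcongr
      _ = _ := by ring
  · intro B hB
    change volume.real {x | x ∈ Ω ∧
      hsNormM (LinearMap.toMatrix' (fderiv ℝ f x : Pt →ₗ[ℝ] Pt) - B) < δ} = ν B * volume.real Ω
    rw [← hu.volume_eq B]
    refine congrArg ENNReal.toReal (le_antisymm ?_ ?_)
    · rw [← add_zero (volume (V B)), ← hG0]
      refine (measure_mono ?_).trans (measure_union_le _ _)
      rintro x ⟨hxΩ, hx⟩
      by_cases hxG : x ∈ ⋃ B ∈ ν.support, V B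
      · left
        simp only [Set.mem_iUnion] at hxG
        obtain ⟨C, hC, hxC⟩ := hxG
        by_cases hBC : B = C
        · rwa [hBC]
        · exfalso
          have h1 := hDf C x hxC
          have h2 := hδ' B hB C hC hBC
          have h3 := hsNormM_add_le
            (-(LinearMap.toMatrix' (fderiv ℝ f x : Pt →ₗ[ℝ] Pt) - B))
            (LinearMap.toMatrix' (fderiv ℝ f x : Pt →ₗ[ℝ] Pt) - C)
          rw [hsNormM_neg, neg_sub, sub_add_sub_cancel] at h3
          linarith
      · exact Or.inr ⟨hxΩ, hxG⟩
    · exact measure_mono fun x hx => ⟨hu.subset B hx, hDf B x hx⟩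
  · rw [ae_iff]
    refine measure_mono_null ?_ hG0
    intro x hx
    simp only [Set.mem_ofPred_eq, Classical.not_imp, not_lt] at hx
    refine ⟨hx.1, fun hxG => ?_⟩
    simp only [Set.mem_iUnion] at hxG
    obtain ⟨B, hB, hxB⟩ := hxG
    refine absurd (lt_of_le_of_lt ?_ (hDf B x hxB)) (not_lt.2 hx.2)
    refine csInf_le ⟨0, ?_⟩ ⟨B, hB, rfl⟩
    rintro r ⟨Q, -, rfl⟩
    exact Real.sqrt_nonneg _
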